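/- Let R ⊆ T be orders in an étale algebra K such that R^t·T has multiplicator ring T, and set f = (R:T). Then for every fractional R-ideal I₀ with (I₀:I₀) = R there exists a fractional R-ideal I weakly equivalent to I₀ (i.e. 1 ∈ (I:I₀)(I₀:I)) and a fractional T-ideal J with multiplicator ring T such that I·T = J and f·J ⊆ I ⊆ J. -/

import Mathlib

universe u

/-- A `Z`-lattice in `K`: a finitely generated `Z`-submodule containing a `Q`-basis of `K`. -/
def IsLat (Z : Type*) (Q K : Type u) [CommRing Z] [Field Q] [Algebra Z Q]
    [CommRing K] [Algebra Q K] [Algebra Z K] (I : Submodule Z K) : Prop :=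
  I.FG ∧ Submodule.span Q (I : Set K) = ⊤

variable (Z : Type*) (Q K : Type u) [CommRing Z] [IsDedekindDomain Z] [Field Q]
  [Algebra Z Q] [IsFractionRing Z Q] [CommRing K] [Algebra Q K] [Algebra Z K]
  [IsScalarTower Z Q K] [FiniteDimensional Q K] [Algebra.Etale Q K]

/- `R` is an order in the étale algebra `K`: a subring which is a `Z`-lattice.
Fractional `R`-ideals are sub-`R`-modules of `K` which are `Z`-lattices. -/
variable (R : Subalgebra Z K) (hR : IsLat Z Q K (Subalgebra.toSubmodule R))

/-- The trace dual `M^t = {a ∈ K : Tr_{K/Q}(aM) ⊆ Z}` of a fractional `R`-ideal. -/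
def tdualR (M : Submodule ↥R K) : Submodule ↥R K where
  carrier := {a | ∀ x ∈ M, Algebra.trace Q K (a * x) ∈ (algebraMap Z Q).range}
  add_mem' := by
    intro a b ha hb x hx
    rw [add_mul, map_add]
    exact add_mem (ha x hx) (hb x hx)
  zero_mem' := by
    intro x hx
    simp only [zero_mul, map_zero]
    exact zero_mem _
  smul_mem' := by
    intro r a ha x hx
    have h1 : (r • a) * x = a * (r • x) := by
      rw [smul_mul_assoc, mul_comm a x, ← smul_mul_assoc, mul_comm]
    rw [h1]
    exact ha (r • x) (M.smul_mem r hx)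

/-- The trace of an element supported on one factor of a finite product of fields. -/
theorem trace_pi_single {F : Type*} [Field F] {ι : Type*} [Finite ι] [DecidableEq ι]
    (A : ι → Type*) [∀ i, Field (A i)] [∀ i, Algebra F (A i)] [∀ i, Module.Finite F (A i)]
    (i : ι) (a : A i) :
    Algebra.trace F (∀ i, A i) (Pi.single i a) = Algebra.trace F (A i) a := by
  have hcomp : Algebra.lmul F (∀ i, A i) (Pi.single i a) =
      (LinearMap.single F A i) ∘ₗ (Algebra.lmul F (A i) a ∘ₗ LinearMap.proj i) := by
    refine LinearMap.ext fun x ↦ funext fun j ↦ ?_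
    rcases eq_or_ne j i with rfl | h
    · simp
    · simp [h]
  rw [Algebra.trace_apply, Algebra.trace_apply, hcomp, LinearMap.trace_comp_comm']
  congr 1
  ext x
  simp

/-- The trace form of an étale algebra over a field is nondegenerate. -/
theorem traceForm_nondegenerate_of_etale (F A : Type u) [Field F] [CommRing A] [Algebra F A]
    [Algebra.Etale F A] : (Algebra.traceForm F A).Nondegenerate := by
  classical
  obtain ⟨ι, _, B, _, _, e, hB⟩ :=
    (Algebra.Etale.iff_exists_algEquiv_prod F A).1 inferInstance
  have hfin i : Module.Finite F (B i) := (hB i).1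
  have hsep i : Algebra.IsSeparable F (B i) := (hB i).2
  have hrefl : LinearMap.IsRefl (Algebra.traceForm F A) :=
    (Algebra.traceForm_isSymm F).isRefl
  rw [LinearMap.BilinForm.Nondegenerate, hrefl.nondegenerate_iff_separatingLeft]
  intro x hx
  apply e.injective
  rw [map_zero]
  ext i
  refine (traceForm_nondegenerate F (B i)).1 _ fun a ↦ ?_
  have h := hx (e.symm (Pi.single i a))
  rw [Algebra.traceForm_apply, ← Algebra.trace_eq_of_algEquiv e, map_mul,
    AlgEquiv.apply_symm_apply, ← Pi.single_mul_right, trace_pi_single] at h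
  exact h

/-- A lattice in a vector space over the fraction field localizes to the whole space. -/
theorem isLocalizedModule_subtype_of_span_eq_top {A F V : Type*} [CommRing A] [IsDomain A]
    [Field F] [Algebra A F] [IsFractionRing A F] [AddCommGroup V] [Module A V] [Module F V]
    [IsScalarTower A F V] {M : Submodule A V} (hM : Submodule.span F (M : Set V) = ⊤) :
    IsLocalizedModule (nonZeroDivisors A) M.subtype where
  map_units d := by
    have := isLocalizedModule_id (nonZeroDivisors A) V F
    exact IsLocalizedModule.map_units (LinearMap.id : V →ₗ[A] V) d
  surj y := by
    have hy : y ∈ Submodule.span F (M : Set V) := hM ▸ Submodule.mem_top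
    induction hy using Submodule.span_induction with
    | mem x hx => exact ⟨(⟨x, hx⟩, 1), by simp⟩
    | zero => exact ⟨(0, 1), by simp⟩
    | add x y _ _ hx hy =>
      obtain ⟨⟨m, d⟩, hm⟩ := hx
      obtain ⟨⟨n, c⟩, hn⟩ := hy
      refine ⟨(c • m + d • n, d * c), ?_⟩
      simp only [map_add, Submonoid.smul_def, map_smul] at hm hn ⊢
      rw [← hm, ← hn, Submonoid.coe_mul, smul_add, mul_comm, mul_smul, mul_comm, mul_smul]
    | smul q x _ hx =>
      obtain ⟨⟨m, d⟩, hm⟩ := hx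
      obtain ⟨⟨a, b⟩, hab⟩ := IsLocalization.surj (nonZeroDivisors A) q
      refine ⟨(a • m, b * d), ?_⟩
      simp only [Submonoid.smul_def, map_smul] at hm hab ⊢
      rw [← hm, Submonoid.coe_mul, mul_smul, ← smul_comm q (d : A) x, ← smul_assoc,
        Algebra.smul_def, mul_comm, hab, algebraMap_smul]
  exists_of_eq h := ⟨1, by simpa using h⟩

/-- A lattice over a Dedekind domain has a finite system of generators together with dual
elements for the trace form. -/
theorem IsLat.exists_trace_dual_system {M : Submodule Z K} (hM : IsLat Z Q K M) :
    ∃ (n : ℕ) (m a : Fin n → K), (∀ i, m i ∈ M) ∧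
      (∀ i, ∀ x ∈ M, Algebra.trace Q K (a i * x) ∈ (algebraMap Z Q).range) ∧
      (∀ x, x = ∑ i, Algebra.trace Q K (a i * x) • m i) ∧
      (∀ x, x = ∑ i, Algebra.trace Q K (x * m i) • a i) := by
  have hnd := traceForm_nondegenerate_of_etale Q K
  have hloc := isLocalizedModule_subtype_of_span_eq_top hM.2
  have hfin : Module.Finite Z M := Module.Finite.iff_fg.2 hM.1
  have htf : Module.IsTorsionFree Z K := Module.IsTorsionFree.trans Q
  have hfp : Module.FinitePresentation Z M := Module.finitePresentation_of_finite Z M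
  have hproj : Module.Projective Z M := Module.Flat.projective_of_finitePresentation
  obtain ⟨n, f, g, -, -, hfg⟩ := Module.Finite.exists_comp_eq_id_of_projective Z M
  have hunits (d : nonZeroDivisors Z) : IsUnit (algebraMap Z (Module.End Z Q) d) := by
    have := isLocalizedModule_id (nonZeroDivisors Z) Q Q
    exact IsLocalizedModule.map_units (LinearMap.id : Q →ₗ[Z] Q) d
  let φ (i : Fin n) : K →ₗ[Q] Q :=
    (IsLocalizedModule.lift (nonZeroDivisors Z) M.subtype
      (Algebra.linearMap Z Q ∘ₗ LinearMap.proj i ∘ₗ g) hunits).extendScalarsOfIsLocalization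
        (nonZeroDivisors Z) Q
  have hφ i (x : M) : φ i x = algebraMap Z Q (g x i) :=
    IsLocalizedModule.lift_apply (nonZeroDivisors Z) M.subtype _ hunits x
  let a i := ((Algebra.traceForm Q K).toDual hnd).symm (φ i)
  have ha i x : Algebra.trace Q K (a i * x) = φ i x :=
    LinearMap.BilinForm.apply_toDual_symm_apply (hB := hnd) _ _
  let m (i : Fin n) : K := f (Pi.single i 1)
  have hmem (x : M) : (x : K) = ∑ i, Algebra.trace Q K (a i * x) • m i := by
    have h := congrArg (M.subtype) (LinearMap.congr_fun hfg x)
    rw [LinearMap.comp_apply, LinearMap.pi_apply_eq_sum_univ f (g x)] at h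
    simp only [map_sum, map_smul, LinearMap.id_apply, Submodule.subtype_apply] at h
    rw [← h]
    refine Finset.sum_congr rfl fun i _ ↦ ?_
    rw [h, ha, hφ, algebraMap_smul]
    congr 3
    ext j
    simp [Pi.single_apply, eq_comm]
  have hall (x : K) : x = ∑ i, Algebra.trace Q K (a i * x) • m i := by
    have hx : x ∈ Submodule.span Q (M : Set K) := hM.2 ▸ Submodule.mem_top
    induction hx using Submodule.span_induction with
    | mem x hx => exact hmem ⟨x, hx⟩
    | zero => simp
    | add x y _ _ hx hy =>
      simp only [mul_add, map_add, add_smul, Finset.sum_add_distrib]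
      rw [← hx, ← hy]
    | smul q x _ hx =>
      simp only [mul_smul_comm, map_smul, smul_assoc, ← Finset.smul_sum]
      rw [← hx]
  refine ⟨n, m, a, fun i ↦ (f _).2, fun i x hx ↦ ⟨g ⟨x, hx⟩ i, ?_⟩, hall, fun x ↦ ?_⟩
  · rw [ha, ← hφ]
  · rw [← sub_eq_zero]
    refine hnd.1 _ fun y ↦ ?_
    rw [Algebra.traceForm_apply, sub_mul, map_sub, sub_eq_zero]
    conv_lhs => rw [hall y]
    simp only [Finset.mul_sum, Finset.sum_mul, map_sum, mul_smul_comm, smul_mul_assoc, map_smul,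
      smul_eq_mul]
    exact Finset.sum_congr rfl fun i _ ↦ mul_comm _ _

variable {Z Q K R}

set_option linter.unusedSectionVars false

theorem mem_tdualR {M : Submodule R K} {a : K} :
    a ∈ tdualR Z Q K R M ↔ ∀ x ∈ M, Algebra.trace Q K (a * x) ∈ (algebraMap Z Q).range :=
  Iff.rfl

/-- Linear combinations with coefficients in the image of `Z` stay in a submodule. -/
theorem sum_smul_mem_of_mem_range {M : Submodule R K} {n : ℕ} {c : Fin n → Q} {m : Fin n → K}
    (hc : ∀ i, c i ∈ (algebraMap Z Q).range) (hm : ∀ i, m i ∈ M) : ∑ i, c i • m i ∈ M := by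
  refine sum_mem fun i _ ↦ ?_
  obtain ⟨z, hz⟩ := hc i
  rw [← hz, algebraMap_smul]
  exact (M.restrictScalars Z).smul_mem z (hm i)

theorem tdualR_tdualR_le {M : Submodule R K} (hM : IsLat Z Q K (M.restrictScalars Z)) :
    tdualR Z Q K R (tdualR Z Q K R M) ≤ M := by
  intro x hx
  obtain ⟨n, m, a, hm, ha, h, -⟩ := hM.exists_trace_dual_system
  rw [h x]
  refine sum_smul_mem_of_mem_range (fun i ↦ ?_) hm
  rw [mul_comm]
  exact hx _ (ha i)

theorem isLat_tdualR {M : Submodule R K} (hM : IsLat Z Q K (M.restrictScalars Z)) :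
    IsLat Z Q K ((tdualR Z Q K R M).restrictScalars Z) := by
  obtain ⟨n, m, a, hm, ha, -, h⟩ := hM.exists_trace_dual_system
  constructor
  · have heq : (tdualR Z Q K R M).restrictScalars Z = Submodule.span Z (Set.range a) := by
      refine le_antisymm (fun x hx ↦ ?_) (Submodule.span_le.2 ?_)
      · rw [h x]
        refine sum_mem fun i _ ↦ ?_
        obtain ⟨z, hz⟩ := hx (m i) (hm i)
        rw [← hz, algebraMap_smul]
        exact Submodule.smul_mem _ z (Submodule.subset_span ⟨i, rfl⟩)
      · rintro _ ⟨i, rfl⟩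
        exact ha i
    rw [heq]
    exact Submodule.fg_span (Set.finite_range a)
  · refine eq_top_iff.2 fun x _ ↦ ?_
    rw [h x]
    exact sum_mem fun i _ ↦ Submodule.smul_mem _ _ (Submodule.subset_span (ha i))

theorem IsLat.mul {M N : Submodule R K} (hM : IsLat Z Q K (M.restrictScalars Z))
    (hN : IsLat Z Q K (N.restrictScalars Z)) : IsLat Z Q K ((M * N).restrictScalars Z) := by
  refine ⟨?_, ?_⟩
  · rw [Submodule.restrictScalars_mul]
    exact hM.1.mul hN.1
  · have hle : Submodule.span Q (M : Set K) * Submodule.span Q (N : Set K) ≤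
        Submodule.span Q ((M * N : Submodule R K) : Set K) := by
      rw [Submodule.span_mul_span]
      exact Submodule.span_mono (Submodule.mul_subset_mul M N)
    have hM' : Submodule.span Q (M : Set K) = ⊤ := hM.2
    have hN' : Submodule.span Q (N : Set K) = ⊤ := hN.2
    rw [hM', hN'] at hle
    refine eq_top_iff.2 fun x _ ↦ hle ?_
    simpa using Submodule.mul_mem_mul (Submodule.mem_top : x ∈ (⊤ : Submodule Q K))
      (Submodule.mem_top : (1 : K) ∈ (⊤ : Submodule Q K))

/-- If `I` has multiplicator ring `R`, then `I * I^t = R^t`. -/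
theorem mul_tdualR_eq_tdualR_one {I : Submodule R K} (hI : IsLat Z Q K (I.restrictScalars Z))
    (hmult : I / I = 1) : I * tdualR Z Q K R I = tdualR Z Q K R 1 := by
  apply le_antisymm
  · refine Submodule.mul_le.2 fun m hm a ha ↦ mem_tdualR.2 fun r hr ↦ ?_
    rw [mul_comm m a, mul_assoc]
    refine ha _ ?_
    rw [← mul_one I]
    exact Submodule.mul_mem_mul hm hr
  · refine le_trans (fun x hx ↦ mem_tdualR.2 fun a ha ↦ ?_)
      (tdualR_tdualR_le (hI.mul (isLat_tdualR hI)))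
    refine hx a ?_
    rw [← hmult, Submodule.mem_div_iff_forall_mul_mem]
    refine fun m hm ↦ tdualR_tdualR_le hI (mem_tdualR.2 fun b hb ↦ ?_)
    rw [mul_assoc]
    exact ha _ (Submodule.mul_mem_mul hm hb)

variable (Z Q K R)

/-- Let `R ⊆ T` be orders (with `T` viewed as the fractional `R`-ideal `TM`) such that
`R^t·T` has multiplicator ring `T`, and let `f = (R : T) = 1 / TM` be the conductor. Then
every fractional `R`-ideal `I₀` with `(I₀ : I₀) = R` is weakly equivalent to a fractional
`R`-ideal `I` such that `J = I·T` is a fractional `T`-ideal with multiplicator ring `T`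
and `f·J ⊆ I ⊆ J`. -/
theorem good_representative_exists (T : Subalgebra Z K)
    (hT : IsLat Z Q K (Subalgebra.toSubmodule T)) (hRT : R ≤ T)
    (TM : Submodule ↥R K) (hTM : (TM : Set K) = (T : Set K))
    (hdual : (tdualR Z Q K R 1 * TM) / (tdualR Z Q K R 1 * TM) = TM)
    (I₀ : Submodule ↥R K) (hI₀ : IsLat Z Q K (I₀.restrictScalars Z))
    (hI₀mult : I₀ / I₀ = 1) :
    ∃ I J : Submodule ↥R K,
      IsLat Z Q K (I.restrictScalars Z) ∧ IsLat Z Q K (J.restrictScalars Z) ∧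
      (1 : K) ∈ (I / I₀) * (I₀ / I) ∧
      TM * J = J ∧ J / J = TM ∧
      I * TM = J ∧ (1 / TM) * J ≤ I ∧ I ≤ J := by
  have hmemT {x : K} : x ∈ TM ↔ x ∈ T := Set.ext_iff.1 hTM x
  have hone : (1 : K) ∈ TM := hmemT.2 T.one_mem
  have hle : I₀ ≤ I₀ * TM := fun x hx ↦ by
    simpa using Submodule.mul_mem_mul hx hone
  have hTT : TM * TM = TM := by
    refine le_antisymm (Submodule.mul_le.2 fun x hx y hy ↦ ?_) fun x hx ↦ ?_
    · exact hmemT.2 (T.mul_mem (hmemT.1 hx) (hmemT.1 hy))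
    · simpa using Submodule.mul_mem_mul hx hone
  have hTlat : IsLat Z Q K (TM.restrictScalars Z) := by
    have heq : TM.restrictScalars Z = Subalgebra.toSubmodule T := SetLike.coe_injective hTM
    rwa [heq]
  have hTJ : TM * (I₀ * TM) = I₀ * TM := by
    rw [mul_left_comm, hTT]
  refine ⟨I₀, I₀ * TM, hI₀, hI₀.mul hTlat, ?_, hTJ, le_antisymm ?_ ?_, rfl, ?_, hle⟩
  · rw [hI₀mult, one_mul]
    exact Submodule.one_le.1 le_rfl
  · have hD : tdualR Z Q K R 1 * TM = I₀ * TM * tdualR Z Q K R I₀ := by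
      rw [← mul_tdualR_eq_tdualR_one hI₀ hI₀mult, mul_right_comm]
    rw [hD] at hdual
    refine le_trans ?_ hdual.le
    rw [Submodule.le_div_iff_mul_le, ← mul_assoc]
    exact mul_le_mul' (Submodule.le_div_iff_mul_le.1 le_rfl) le_rfl
  · rw [Submodule.le_div_iff_mul_le, hTJ]
  · rw [mul_left_comm]
    refine (mul_le_mul' le_rfl (Submodule.le_div_iff_mul_le.1 le_rfl)).trans ?_
    rw [mul_one]
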